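/- arXiv:2603.20587 — 3 statements merged into one kernel-verified Lean document; each statement's English description precedes it below -/
import Mathlib

section
/- Fix d ≥ 2 and n ≥ d+2. Given a configuration X = {x_1,…,x_n} on the unit sphere S^{d−1} in ℝ^d, suppose there exists a partition [n] = A ⊔ B with both A and B nonempty such that the intersection K := conv{x_i : i∈A} ∩ conv{x_i : i∈B} is nonempty and does not contain the origin. Then δ(X) < 1. -/
/-- The minimum distance from a point of the configuration to the convex hull
of the remaining points. -/
noncomputable def sdelta {d n : ℕ} (x : Fin n → EuclideanSpace ℝ (Fin d)) : ℝ :=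
  ⨅ j : Fin n, Metric.infDist (x j) (convexHull ℝ (x '' {i | i ≠ j}))

/-- A point of the convex hull of `s` has inner product with itself at most that with some point
of `s`. -/
theorem exists_norm_sq_le_inner_of_mem_convexHull {E : Type*} [NormedAddCommGroup E]
    [InnerProductSpace ℝ E] {s : Set E} {z : E} (hz : z ∈ convexHull ℝ s) :
    ∃ y ∈ s, ‖z‖ ^ 2 ≤ inner ℝ z y := by
  by_contra! h
  have hconv : Convex ℝ {y : E | inner ℝ z y < ‖z‖ ^ 2} :=
    convex_halfSpace_lt (innerₛₗ ℝ z).isLinear _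
  have hlt : inner ℝ z z < ‖z‖ ^ 2 := convexHull_min h hconv hz
  rw [real_inner_self_eq_norm_sq] at hlt
  exact lt_irrefl _ hlt

theorem stmt1 (d n : ℕ) (hd : 2 ≤ d) (hn : d + 2 ≤ n)
    (x : Fin n → EuclideanSpace ℝ (Fin d)) (hx : ∀ i, ‖x i‖ = 1)
    (A : Set (Fin n)) (hA : A.Nonempty) (hB : Aᶜ.Nonempty)
    (hK : (convexHull ℝ (x '' A) ∩ convexHull ℝ (x '' Aᶜ)).Nonempty)
    (h0 : (0 : EuclideanSpace ℝ (Fin d)) ∉ convexHull ℝ (x '' A) ∩ convexHull ℝ (x '' Aᶜ)) :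
    sdelta x < 1 := by
  obtain ⟨z, hz⟩ := hK
  have hz0 : z ≠ 0 := fun h => h0 (h ▸ hz)
  obtain ⟨_, ⟨j, hj, rfl⟩, hle⟩ := exists_norm_sq_le_inner_of_mem_convexHull hz.1
  have hmem : z ∈ convexHull ℝ (x '' {i | i ≠ j}) :=
    convexHull_mono (Set.image_mono fun i (hi : i ∉ A) (hij : i = j) => hi (hij ▸ hj)) hz.2
  have hpos : 0 < ‖z‖ ^ 2 := by positivity
  have hsq : ‖x j - z‖ ^ 2 < 1 := by
    rw [norm_sub_sq_real, hx, real_inner_comm]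
    linarith
  calc sdelta x ≤ Metric.infDist (x j) (convexHull ℝ (x '' {i | i ≠ j})) :=
        ciInf_le (Set.finite_range _).bddBelow j
    _ ≤ dist (x j) z := Metric.infDist_le_dist_of_mem hmem
    _ = ‖x j - z‖ := dist_eq_norm _ _
    _ < 1 := (sq_lt_one_iff₀ (norm_nonneg _)).mp hsq
end

section
/- Fix d ≥ 2 and an integer n with d+2 ≤ n ≤ 2d. Every softmax code X = {x_1,…,x_n} on the unit sphere S^{d−1} in ℝ^d has no softmax rattler; that is, dist(x_j, conv{x_i : i≠j}) = δ(X) for every j ∈ [n]. -/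
open scoped RealInnerProductSpace

section InnerProductSpace

variable {ι E : Type*} [NormedAddCommGroup E] [InnerProductSpace ℝ E]

/-- A unit vector having nonpositive inner product with every point of a nonempty set is at
distance at least one from the convex hull of that set. -/
lemma one_le_infDist_convexHull_of_inner_nonpos {s : Set E} (hs : s.Nonempty) {u : E}
    (hu : ‖u‖ = 1) (h : ∀ y ∈ s, ⟪u, y⟫ ≤ 0) :
    1 ≤ Metric.infDist u (convexHull ℝ s) := by
  have hsub : convexHull ℝ s ⊆ {y | ⟪u, y⟫ ≤ 0} :=
    convexHull_min h (convex_halfSpace_le (innerₛₗ ℝ u).isLinear 0)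
  refine (Metric.le_infDist hs.convexHull).2 fun y hy => ?_
  have h₁ : ⟪u, y⟫ ≤ 0 := hsub hy
  have h₂ : ⟪u, u - y⟫ ≤ ‖u‖ * ‖u - y‖ := real_inner_le_norm _ _
  rw [inner_sub_right, real_inner_self_eq_norm_sq, hu] at h₂
  rw [dist_eq_norm]
  linarith

/-- A linear relation with nonnegative total weight among unit vectors yields either a convex
combination equal to zero or a vector at distance less than one from the hull of the others. -/
lemma zero_mem_convexHull_or_norm_sub_lt_one_of_sum_nonneg [Fintype ι] {x : ι → E}
    (hx : ∀ i, ‖x i‖ = 1) {c : ι → ℝ} (hc : ∑ i, c i • x i = 0) (hne : ∃ i, c i ≠ 0)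
    (hsum : 0 ≤ ∑ i, c i) :
    0 ∈ convexHull ℝ (Set.range x) ∨
      ∃ k, ∃ v ∈ convexHull ℝ (x '' {i | i ≠ k}), ‖x k - v‖ < 1 := by
  classical
  set t : Finset ι := {i | 0 < c i} with ht
  have hpos : ∀ i ∈ t, 0 < c i := fun i hi => by simpa [ht] using hi
  have hnonpos : ∀ i ∈ tᶜ, c i ≤ 0 := fun i hi => by simpa [ht] using hi
  have htne : t.Nonempty := by
    by_contra h
    rw [Finset.not_nonempty_iff_eq_empty] at h
    have hle : ∀ i ∈ Finset.univ, c i ≤ 0 := fun i _ => hnonpos i (by simp [h])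
    obtain ⟨i, hi⟩ := hne
    exact hi ((Finset.sum_eq_zero_iff_of_nonpos hle).1
      (le_antisymm (Finset.sum_nonpos hle) hsum) i (Finset.mem_univ i))
  have hA : 0 < ∑ i ∈ t, c i := Finset.sum_pos hpos htne
  set v := t.centerMass c x with hv
  have hmem : ∀ s : Set E, (∀ i ∈ t, x i ∈ s) → v ∈ convexHull ℝ s := fun s hs =>
    t.centerMass_mem_convexHull (fun i hi => (hpos i hi).le) hA hs
  by_cases hv0 : v = 0
  · exact Or.inl (hv0 ▸ hmem _ fun i _ => Set.mem_range_self i)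
  right
  suffices h : ∃ k ∈ tᶜ, ‖v‖ ^ 2 < 2 * ⟪x k, v⟫ by
    obtain ⟨k, hk, hlt⟩ := h
    refine ⟨k, v, hmem _ fun i hi => ⟨i, ?_, rfl⟩, ?_⟩
    · rintro rfl
      exact Finset.mem_compl.1 hk hi
    · have := norm_sub_sq_real (x k) v
      rw [hx k] at this
      nlinarith [norm_nonneg (x k - v)]
  by_contra! h
  have hAv : (∑ i ∈ t, c i) • v = ∑ i ∈ t, c i • x i := by
    rw [hv, Finset.centerMass, smul_inv_smul₀ hA.ne']
  have hsplit : (∑ i ∈ t, c i) • v + ∑ i ∈ tᶜ, c i • x i = 0 := by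
    rw [hAv, Finset.sum_add_sum_compl, hc]
  have hinner : (∑ i ∈ t, c i) * ‖v‖ ^ 2 + ∑ i ∈ tᶜ, c i * ⟪x i, v⟫ = 0 := by
    have := congrArg (fun w => ⟪w, v⟫) hsplit
    simpa only [inner_add_left, sum_inner, real_inner_smul_left, real_inner_self_eq_norm_sq,
      inner_zero_left] using this
  have hle : (∑ i ∈ tᶜ, c i) * (‖v‖ ^ 2 / 2) ≤ ∑ i ∈ tᶜ, c i * ⟪x i, v⟫ := by
    rw [Finset.sum_mul]
    exact Finset.sum_le_sum fun i hi =>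
      mul_le_mul_of_nonpos_left (by linarith [h i hi]) (hnonpos i hi)
  have hvpos : 0 < ‖v‖ ^ 2 := by positivity
  rw [← Finset.sum_add_sum_compl t] at hsum
  nlinarith [mul_pos hA hvpos, mul_nonneg hsum hvpos.le]

/-- Linearly dependent unit vectors have zero in their convex hull, or one of them is at distance
less than one from the convex hull of the others. -/
lemma zero_mem_convexHull_or_norm_sub_lt_one [Fintype ι] {x : ι → E}
    (hx : ∀ i, ‖x i‖ = 1) (hdep : ¬ LinearIndependent ℝ x) :
    0 ∈ convexHull ℝ (Set.range x) ∨
      ∃ k, ∃ v ∈ convexHull ℝ (x '' {i | i ≠ k}), ‖x k - v‖ < 1 := by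
  obtain ⟨c, hc, hne⟩ := Fintype.not_linearIndependent_iff.1 hdep
  rcases le_total 0 (∑ i, c i) with h | h
  · exact zero_mem_convexHull_or_norm_sub_lt_one_of_sum_nonneg hx hc hne h
  · refine zero_mem_convexHull_or_norm_sub_lt_one_of_sum_nonneg (c := fun i => -c i) hx ?_ ?_ ?_
    · simpa using hc
    · simpa using hne
    · simpa using h

end InnerProductSpace

lemma sdelta_le_infDist {d n : ℕ} (x : Fin n → EuclideanSpace ℝ (Fin d)) (j : Fin n) :
    sdelta x ≤ Metric.infDist (x j) (convexHull ℝ (x '' {i | i ≠ j})) :=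
  ciInf_le (Set.finite_range _).bddBelow j

/-- Unit vectors with pairwise nonpositive inner products form a configuration with `sdelta`
at least one. -/
lemma one_le_sdelta_of_pairwise_inner_nonpos {d n : ℕ} (hn : 2 ≤ n)
    {x : Fin n → EuclideanSpace ℝ (Fin d)} (hx : ∀ i, ‖x i‖ = 1)
    (h : ∀ i j, i ≠ j → ⟪x i, x j⟫ ≤ 0) : 1 ≤ sdelta x := by
  have : Nontrivial (Fin n) := Fin.nontrivial_iff_two_le.2 hn
  refine le_ciInf fun j => one_le_infDist_convexHull_of_inner_nonpos ?_ (hx j) ?_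
  · obtain ⟨i, hi⟩ := exists_ne j
    exact ⟨x i, i, hi, rfl⟩
  · rintro _ ⟨i, hi, rfl⟩
    exact h j i (Ne.symm hi)

/-- Up to `2 * d` vertices of the cross-polytope give unit vectors with pairwise nonpositive
inner products. -/
lemma exists_pairwise_inner_nonpos {d n : ℕ} (hn : n ≤ 2 * d) :
    ∃ y : Fin n → EuclideanSpace ℝ (Fin d),
      (∀ i, ‖y i‖ = 1) ∧ ∀ i j, i ≠ j → ⟪y i, y j⟫ ≤ 0 := by
  refine ⟨fun i => if h : i.1 < d then EuclideanSpace.single ⟨i.1, h⟩ 1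
    else -EuclideanSpace.single ⟨i.1 - d, by omega⟩ 1, fun i => ?_, fun i j hij => ?_⟩
  · dsimp only
    split_ifs <;> simp
  · have hij' : i.1 ≠ j.1 := fun h => hij (Fin.ext h)
    dsimp only
    split_ifs with hi hj hj
    · simp [EuclideanSpace.inner_single_left, Fin.ext_iff, hij']
    · simp only [EuclideanSpace.inner_single_left, PiLp.neg_apply, PiLp.single_apply]
      split_ifs <;> simp
    · simp only [inner_neg_left, EuclideanSpace.inner_single_left, PiLp.single_apply]
      split_ifs <;> simp
    · have : i.1 - d ≠ j.1 - d := by omega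
      simp [EuclideanSpace.inner_single_left, Fin.ext_iff, this]

theorem stmt4 (d n : ℕ) (hd : 2 ≤ d) (hn₁ : d + 2 ≤ n) (hn₂ : n ≤ 2 * d)
    (x : Fin n → EuclideanSpace ℝ (Fin d)) (hx : ∀ i, ‖x i‖ = 1)
    (hmax : ∀ y : Fin n → EuclideanSpace ℝ (Fin d), (∀ i, ‖y i‖ = 1) → sdelta y ≤ sdelta x) :
    ∀ j, Metric.infDist (x j) (convexHull ℝ (x '' {i | i ≠ j})) = sdelta x := by
  intro j
  obtain ⟨y, hy, hyy⟩ := exists_pairwise_inner_nonpos hn₂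
  have hone : 1 ≤ sdelta x :=
    (one_le_sdelta_of_pairwise_inner_nonpos (by omega) hy hyy).trans (hmax y hy)
  refine le_antisymm (le_trans ?_ hone) (sdelta_le_infDist x j)
  have hdep : ¬ LinearIndependent ℝ fun i : {i // i ≠ j} => x i := fun h => by
    have := h.fintype_card_le_finrank
    rw [finrank_euclideanSpace_fin, Fintype.card_subtype_compl] at this
    simp only [Fintype.card_fin, Fintype.card_unique] at this
    omega
  rcases zero_mem_convexHull_or_norm_sub_lt_one (fun i : {i // i ≠ j} => hx i) hdep with
    h | ⟨k, v, hv, hlt⟩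
  · have h₀ : (0 : EuclideanSpace ℝ (Fin d)) ∈ convexHull ℝ (x '' {i | i ≠ j}) := by
      refine convexHull_mono ?_ h
      rintro _ ⟨i, rfl⟩
      exact ⟨i, i.2, rfl⟩
    simpa [hx j] using Metric.infDist_le_dist_of_mem (x := x j) h₀
  · have hv' : v ∈ convexHull ℝ (x '' {i | i ≠ k.1}) := by
      refine convexHull_mono ?_ hv
      rintro _ ⟨i, hi, rfl⟩
      exact ⟨i, fun h => hi (Subtype.ext h), rfl⟩
    have := Metric.infDist_le_dist_of_mem (x := x k) hv'
    rw [dist_eq_norm] at this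
    linarith [sdelta_le_infDist x k.1]
end

section
/- For every integer n > 1, there exists a threshold τ_−(n) > 0 such that for every 0 < τ < τ_−(n), the function f_{n,τ}(x) = (x+1)·log( n − x − 1 + e^{1/τ} + x·e^{−1/(τx)} ) is strictly concave on the interval [1, n−1]. -/
/-- The function `f_{n,τ}(x) = (x+1)·log( n − x − 1 + e^{1/τ} + x·e^{−1/(τx)} )`. -/
noncomputable def fnt (n : ℕ) (τ : ℝ) (x : ℝ) : ℝ :=
  (x + 1) * Real.log ((n : ℝ) - x - 1 + Real.exp (1 / τ) + x * Real.exp (-1 / (τ * x)))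

/-- The argument of the logarithm in `fnt`, with `M = n - 1` and inverse temperature `a = 1 / τ`. -/
noncomputable def logArg (M a x : ℝ) : ℝ :=
  M - x + Real.exp a + x * Real.exp (-a / x)

/-- The derivative of `logArg M a`. -/
noncomputable def logArgDeriv (a x : ℝ) : ℝ :=
  -1 + Real.exp (-a / x) * (1 + a / x)

theorem fnt_eq (n : ℕ) (τ x : ℝ) :
    fnt n τ x = (x + 1) * Real.log (logArg ((n : ℝ) - 1) (1 / τ) x) := by
  have h : -1 / (τ * x) = -(1 / τ) / x := by
    rw [← div_div, neg_div]
  rw [fnt, logArg, h]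
  ring_nf

theorem logArg_pos {M a x : ℝ} (hx : 0 < x) (hxM : x ≤ M) : 0 < logArg M a x := by
  have h₁ := Real.exp_pos a
  have h₂ := mul_pos hx (Real.exp_pos (-a / x))
  unfold logArg
  linarith

theorem hasDerivAt_exp_neg_div {a x : ℝ} (hx : x ≠ 0) :
    HasDerivAt (fun y => Real.exp (-a / y)) (Real.exp (-a / x) * (a / x ^ 2)) x := by
  have h := ((hasDerivAt_const x (-a)).div (hasDerivAt_id x) hx).exp
  refine h.congr_deriv ?_
  simp [neg_div]

theorem hasDerivAt_logArg {M a x : ℝ} (hx : x ≠ 0) :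
    HasDerivAt (logArg M a) (logArgDeriv a x) x := by
  have h := (((hasDerivAt_id x).const_sub M).add_const (Real.exp a)).add
    ((hasDerivAt_id x).mul (hasDerivAt_exp_neg_div (a := a) hx))
  refine h.congr_deriv ?_
  simp only [logArgDeriv, id]
  field_simp

theorem hasDerivAt_logArgDeriv {a x : ℝ} (hx : x ≠ 0) :
    HasDerivAt (logArgDeriv a) (Real.exp (-a / x) * (a ^ 2 / x ^ 3)) x := by
  have h := ((hasDerivAt_exp_neg_div (a := a) hx).mul
    (((hasDerivAt_const x a).div (hasDerivAt_id x) hx).const_add 1)).const_add (-1)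
  refine h.congr_deriv ?_
  simp only [id, Pi.div_apply]
  field_simp
  ring

theorem hasDerivAt_mul_log_logArg {M a x : ℝ} (hx : 0 < x) (hxM : x ≤ M) :
    HasDerivAt (fun y => (y + 1) * Real.log (logArg M a y))
      (Real.log (logArg M a x) + (x + 1) * (logArgDeriv a x / logArg M a x)) x := by
  have h := ((hasDerivAt_id x).add_const 1).mul
    ((hasDerivAt_logArg (M := M) (a := a) hx.ne').log (logArg_pos hx hxM).ne')
  refine h.congr_deriv ?_
  simp

theorem hasDerivAt_deriv_mul_log_logArg {M a x : ℝ} (hx : 0 < x) (hxM : x ≤ M) :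
    HasDerivAt
      (fun y => Real.log (logArg M a y) + (y + 1) * (logArgDeriv a y / logArg M a y))
      ((2 * logArgDeriv a x + (x + 1) * (Real.exp (-a / x) * (a ^ 2 / x ^ 3))
        - (x + 1) * (logArgDeriv a x ^ 2 / logArg M a x)) / logArg M a x) x := by
  have hg := (logArg_pos (a := a) hx hxM).ne'
  have hd := hasDerivAt_logArg (M := M) (a := a) hx.ne'
  have h := (hd.log hg).add (((hasDerivAt_id x).add_const 1).mul
    ((hasDerivAt_logArgDeriv (a := a) hx.ne').div hd hg))
  refine h.congr_deriv ?_
  simp only [id, Pi.div_apply]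
  field_simp
  ring

theorem quadratic_lt_exp_div {M a : ℝ} (hM : 1 ≤ M) (ha : 18 * M ^ 3 < a) :
    1 + a + a ^ 2 < Real.exp (a / M) := by
  have hM3 : 1 ≤ M ^ 3 := one_le_pow₀ hM
  have ha₁ : 1 < a := by linarith
  have h := Real.pow_div_factorial_le_exp (a / M) (by positivity) 3
  have hcube : 3 * a ^ 2 ≤ (a / M) ^ 3 / (Nat.factorial 3 : ℝ) := by
    have h6 : (Nat.factorial 3 : ℝ) = 6 := by norm_num [Nat.factorial]
    rw [h6, div_pow, div_div, le_div_iff₀ (by positivity)]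
    nlinarith [mul_le_mul_of_nonneg_left ha.le (sq_nonneg a)]
  nlinarith

theorem two_mul_logArgDeriv_add_neg {M a x : ℝ} (ha : 18 * M ^ 3 < a) (hx : 1 ≤ x)
    (hxM : x ≤ M) :
    2 * logArgDeriv a x + (x + 1) * (Real.exp (-a / x) * (a ^ 2 / x ^ 3)) < 0 := by
  have hM : 1 ≤ M := hx.trans hxM
  have hM3 : 1 ≤ M ^ 3 := one_le_pow₀ hM
  have ha₀ : 0 < a := by linarith
  have hx₀ : 0 < x := by linarith
  have hq := Real.exp_pos (-a / x)
  have hexp : (1 + a + a ^ 2) * Real.exp (-a / x) < 1 := by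
    rw [neg_div, Real.exp_neg, ← div_eq_mul_inv, div_lt_one (Real.exp_pos _)]
    refine (quadratic_lt_exp_div hM ha).trans_le (Real.exp_le_exp.2 ?_)
    gcongr
  have h₁ : a / x ≤ a := div_le_self ha₀.le hx
  have h₂ : (x + 1) * (a ^ 2 / x ^ 3) ≤ 2 * a ^ 2 := by
    have hx3 : x ≤ x ^ 3 := le_self_pow₀ hx (by norm_num)
    rw [← mul_div_assoc, div_le_iff₀ (by positivity)]
    nlinarith [sq_nonneg a]
  have h₃ := mul_le_mul_of_nonneg_left h₁ hq.le
  have h₄ := mul_le_mul_of_nonneg_left h₂ hq.le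
  unfold logArgDeriv
  nlinarith

theorem strictConcaveOn_mul_log_logArg {M a : ℝ} (ha : 18 * M ^ 3 < a) :
    StrictConcaveOn ℝ (Set.Icc 1 M) (fun x => (x + 1) * Real.log (logArg M a x)) := by
  refine strictConcaveOn_of_deriv2_neg (convex_Icc 1 M) (fun x hx =>
    (hasDerivAt_mul_log_logArg (by linarith [hx.1]) hx.2).continuousAt.continuousWithinAt) ?_
  intro x hx
  rw [interior_Icc] at hx
  have hx₀ : 0 < x := by linarith [hx.1]
  have hg := logArg_pos (a := a) hx₀ hx.2.le
  have hderiv : deriv (fun y => (y + 1) * Real.log (logArg M a y)) =ᶠ[nhds x]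
      fun y => Real.log (logArg M a y) + (y + 1) * (logArgDeriv a y / logArg M a y) := by
    filter_upwards [Ioo_mem_nhds hx.1 hx.2] with y hy
    exact (hasDerivAt_mul_log_logArg (by linarith [hy.1]) hy.2.le).deriv
  rw [Function.iterate_succ_apply, Function.iterate_one, hderiv.deriv_eq,
    (hasDerivAt_deriv_mul_log_logArg hx₀ hx.2.le).deriv]
  have hsq : 0 ≤ (x + 1) * (logArgDeriv a x ^ 2 / logArg M a x) := by positivity
  exact div_neg_of_neg_of_pos
    (by linarith [two_mul_logArgDeriv_add_neg ha hx.1.le hx.2.le]) hg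

theorem stmt10 (n : ℕ) (hn : 1 < n) :
    ∃ τm : ℝ, 0 < τm ∧ ∀ τ : ℝ, 0 < τ → τ < τm →
      StrictConcaveOn ℝ (Set.Icc (1 : ℝ) ((n : ℝ) - 1)) (fnt n τ) := by
  have hM : 0 < (n : ℝ) - 1 := sub_pos.2 (by exact_mod_cast hn)
  refine ⟨1 / (18 * ((n : ℝ) - 1) ^ 3), by positivity, fun τ hτ hlt => ?_⟩
  rw [funext (fnt_eq n τ)]
  exact strictConcaveOn_mul_log_logArg ((lt_one_div hτ (by positivity)).1 hlt)
end
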